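/- (Local Borg–Marchenko theorem.) Let a, ã : ℕ → ℝ with a_n, ã_n > 0 and b, b̃ : ℕ → ℂ, and suppose the maximal Jacobi operators J = J(a,b) and J̃ = J(ã,b̃) are proper. Let M and M̃ be their Weyl matrix functions, and let N ≥ 2 be an integer. Then the following are equivalent: (1) there exist ε > 0, a constant C > 0, and a sequence (w_j) in ℂ \ [0,∞) with |w_j| → ∞ and arg(w_j) ∈ [ε, 2π − ε] such that ‖w_j^{σ₃/4}(M(w_j) − M̃(w_j))w_j^{σ₃/4}‖ ≤ C|w_j|^{−N} for all j; (2) a_n = ã_n and b_n = b̃_n for all n ≤ N − 2; (3) for every ε > 0 there exist C > 0 and R > 0 such that ‖w^{σ₃/4}(M(w) − M̃(w))w^{σ₃/4}‖ ≤ C|w|^{−N} for all w with |w| ≥ R and arg(w) ∈ [ε, 2π − ε]. -/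

import Mathlib

open scoped InnerProductSpace ComplexConjugate

noncomputable section

/-- The Hilbert space `ℓ²(ℕ₀)` of square-summable complex sequences. -/
abbrev H : Type := lp (fun _ : ℕ => ℂ) 2

/-- The formal Jacobi action: `(Ju)ₙ = aₙ₋₁uₙ₋₁ + bₙuₙ + aₙuₙ₊₁` (with `u₋₁ = 0`). -/
def jacobiAct (a : ℕ → ℝ) (b : ℕ → ℂ) (u : ℕ → ℂ) : ℕ → ℂ := fun n =>
  (if n = 0 then 0 else (a (n - 1) : ℂ) * u (n - 1)) + b n * u n + (a n : ℂ) * u (n + 1)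

lemma jacobiAct_add (a : ℕ → ℝ) (b : ℕ → ℂ) (u v : ℕ → ℂ) :
    jacobiAct a b (u + v) = jacobiAct a b u + jacobiAct a b v := by
  funext n
  by_cases h : n = 0 <;> simp [jacobiAct, h] <;> ring

lemma jacobiAct_smul (a : ℕ → ℝ) (b : ℕ → ℂ) (c : ℂ) (u : ℕ → ℂ) :
    jacobiAct a b (c • u) = c • jacobiAct a b u := by
  funext n
  by_cases h : n = 0 <;> simp [jacobiAct, h] <;> ring

lemma jacobiAct_zero (a : ℕ → ℝ) (b : ℕ → ℂ) : jacobiAct a b 0 = 0 := by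
  funext n
  by_cases h : n = 0 <;> simp [jacobiAct, h]

/-- The domain of the maximal Jacobi operator: all `u ∈ ℓ²` whose formal Jacobi action is
again in `ℓ²`. -/
def jacobiDomain (a : ℕ → ℝ) (b : ℕ → ℂ) : Submodule ℂ H where
  carrier := {u : H | Memℓp (jacobiAct a b ⇑u) 2}
  zero_mem' := by
    show Memℓp (jacobiAct a b (0 : ℕ → ℂ)) 2
    rw [jacobiAct_zero]
    exact zero_memℓp (E := fun _ : ℕ => ℂ) (p := 2)
  add_mem' := by
    intro u v hu hv
    show Memℓp (jacobiAct a b ((⇑u : ℕ → ℂ) + (⇑v : ℕ → ℂ))) 2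
    rw [jacobiAct_add]
    exact hu.add hv
  smul_mem' := by
    intro c u hu
    simpa [lp.coeFn_smul, jacobiAct_smul] using hu.const_smul c

/-- The maximal Jacobi operator `J(a,b)`, as a partially defined linear operator on
`ℓ²(ℕ₀)`. -/
def jacobiOp (a : ℕ → ℝ) (b : ℕ → ℂ) : H →ₗ.[ℂ] H where
  domain := jacobiDomain a b
  toFun :=
    { toFun := fun u => (⟨jacobiAct a b ⇑(u : H), u.2⟩ : H)
      map_add' := by
        intro u v
        apply Subtype.ext
        exact jacobiAct_add a b ⇑(u : H) ⇑(v : H)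
      map_smul' := by
        intro c u
        apply Subtype.ext
        exact jacobiAct_smul a b c ⇑(u : H) }

/-- The subspace `ℓ²_c(ℕ₀)` of finitely supported sequences. -/
def finSupp : Submodule ℂ H where
  carrier := {u : H | (Function.support ⇑u).Finite}
  zero_mem' := by simp [Function.support]
  add_mem' := by
    intro u v hu hv
    refine Set.Finite.subset (hu.union hv) ?_
    intro n hn
    simp only [Function.mem_support, lp.coeFn_add, Pi.add_apply] at hn
    by_contra hc
    simp only [Set.mem_union, Function.mem_support, not_or, not_not] at hc
    exact hn (by rw [hc.1, hc.2, add_zero])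
  smul_mem' := by
    intro c u hu
    refine Set.Finite.subset hu ?_
    intro n hn
    simp only [Function.mem_support, lp.coeFn_smul, Pi.smul_apply, smul_eq_mul] at hn
    simp only [Function.mem_support]
    intro h
    exact hn (by rw [h, mul_zero])

lemma finSupp_memℓp (a : ℕ → ℝ) (b : ℕ → ℂ) (u : ℕ → ℂ)
    (hu : (Function.support u).Finite) : Memℓp (jacobiAct a b u) 2 := by
  have hfin : (((· + 1) '' Function.support u ∪ Function.support u) ∪
      ((· - 1) '' Function.support u)).Finite :=
    ((hu.image _).union hu).union (hu.image _)
  refine (memℓp_zero (hfin.subset ?_)).of_exponent_ge zero_le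
  intro n hn
  simp only [Set.mem_setOf_eq, jacobiAct] at hn
  by_contra hc
  simp only [Set.mem_union, Set.mem_image, Function.mem_support, not_or, not_exists,
    not_and] at hc
  obtain ⟨⟨h1, h2⟩, h3⟩ := hc
  have e2 : u n = 0 := not_not.1 h2
  have e3 : u (n + 1) = 0 := by
    by_contra hne
    exact h3 (n + 1) hne (by omega)
  apply hn
  by_cases h : n = 0
  · subst h; simp [e2, show u 1 = 0 from e3]
  · have e1 : u (n - 1) = 0 := by
      by_contra hne
      exact h1 (n - 1) hne (by omega)
    simp [h, e1, e2, e3]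

/-- The minimal Jacobi operator `J₀(a,b)`: the restriction of the maximal operator to the
finitely supported sequences. -/
def jacobiOp₀ (a : ℕ → ℝ) (b : ℕ → ℂ) : H →ₗ.[ℂ] H where
  domain := finSupp
  toFun :=
    { toFun := fun u => (⟨jacobiAct a b ⇑(u : H), finSupp_memℓp a b _ u.2⟩ : H)
      map_add' := by
        intro u v
        apply Subtype.ext
        exact jacobiAct_add a b ⇑(u : H) ⇑(v : H)
      map_smul' := by
        intro c u
        apply Subtype.ext
        exact jacobiAct_smul a b c ⇑(u : H) }

/-- The Wronskian `Wₙ(u,v) = aₙ(uₙ₊₁vₙ − uₙvₙ₊₁)`. -/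
def wronskian (a : ℕ → ℝ) (u v : ℕ → ℂ) (n : ℕ) : ℂ :=
  (a n : ℂ) * (u (n + 1) * v n - u n * v (n + 1))


/-- `R` is the resolvent of `J(a,b)*J(a,b)` at the point `w`. -/
def IsJJResolvent (a : ℕ → ℝ) (b : ℕ → ℂ) (w : ℂ) (R : H →L[ℂ] H) : Prop :=
  (∀ x : H, ∃ (h1 : R x ∈ (jacobiOp a b).domain)
      (h2 : jacobiOp a b ⟨R x, h1⟩ ∈ (jacobiOp a b).adjoint.domain),
    (jacobiOp a b).adjoint ⟨jacobiOp a b ⟨R x, h1⟩, h2⟩ - w • R x = x) ∧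
  (∀ (u : H) (h1 : u ∈ (jacobiOp a b).domain)
      (h2 : jacobiOp a b ⟨u, h1⟩ ∈ (jacobiOp a b).adjoint.domain),
    R ((jacobiOp a b).adjoint ⟨jacobiOp a b ⟨u, h1⟩, h2⟩ - w • u) = u)

/-- The pair of vectors `e₀ = δ₀` and `e₁ = J*δ₀ = (conj b₀, a₀, 0, 0, …)`. -/
def weylVec (a : ℕ → ℝ) (b : ℕ → ℂ) : Fin 2 → H :=
  ![lp.single 2 0 (1 : ℂ), lp.single 2 0 (conj (b 0)) + lp.single 2 1 ((a 0 : ℂ))]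

/-- The Weyl matrix `M(w)`, with entries `M_{ij}(w) = ⟨e_j, R_w e_i⟩`, built from a
resolvent family `Res` for `J*J`. -/
def weylM (a : ℕ → ℝ) (b : ℕ → ℂ) (Res : ℂ → H →L[ℂ] H) (w : ℂ) :
    Matrix (Fin 2) (Fin 2) ℂ :=
  Matrix.of fun i j => ⟪weylVec a b j, Res w (weylVec a b i)⟫_ℂ

/-- The argument of a complex number, normalized to take values in `[0, 2π)`. -/
def arg2pi (w : ℂ) : ℝ := if 0 ≤ w.arg then w.arg else w.arg + 2 * Real.pi

/-- The fourth root `w^{1/4}` with `arg (w^{1/4}) ∈ (0, π/2)` for `w ∈ ℂ \ [0,∞)`. -/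
def quarticRoot (w : ℂ) : ℂ :=
  (‖w‖ ^ ((1 : ℝ) / 4) : ℝ) * Complex.exp ((arg2pi w / 4 : ℝ) * Complex.I)

/-- The matrix `w^{σ₃/4} = diag(w^{1/4}, w^{-1/4})`. -/
def sigma3Root (w : ℂ) : Matrix (Fin 2) (Fin 2) ℂ :=
  !![quarticRoot w, 0; 0, (quarticRoot w)⁻¹]

/-- The operator norm (induced by the Euclidean norm on `ℂ²`) of a `2×2` matrix. -/
def opnorm (A : Matrix (Fin 2) (Fin 2) ℂ) : ℝ := ‖Matrix.toEuclideanCLM (𝕜 := ℂ) A‖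

/-- Membership in `ℂ \ [0, +∞)`. -/
def offHalfLine (w : ℂ) : Prop := w.im ≠ 0 ∨ w.re < 0

/-- The alternating orbit of `δ₀`: the word `J(a,b) J(a,b*) J(a,b) ⋯` with `k` letters,
applied to `δ₀`. -/
def jacobiOrbit (a : ℕ → ℝ) : ℕ → (ℕ → ℂ) → ℕ → ℂ
  | 0, _ => Pi.single 0 1
  | k + 1, b => jacobiAct a b (jacobiOrbit a k (star b))

lemma star_jacobiAct (a : ℕ → ℝ) (b u : ℕ → ℂ) :
    star (jacobiAct a b u) = jacobiAct a (star b) (star u) := by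
  funext n
  by_cases h : n = 0 <;> simp [jacobiAct, h]

lemma star_jacobiOrbit (a : ℕ → ℝ) (k : ℕ) (b : ℕ → ℂ) :
    star (jacobiOrbit a k b) = jacobiOrbit a k (star b) := by
  induction k generalizing b with
  | zero =>
    funext n
    by_cases h : n = 0 <;> simp [jacobiOrbit, h]
  | succ k ih => simp only [jacobiOrbit, star_jacobiAct, ih]

lemma jacobiOrbit_star_apply (a : ℕ → ℝ) (k : ℕ) (b : ℕ → ℂ) (n : ℕ) :
    jacobiOrbit a k (star b) n = star (jacobiOrbit a k b n) := by
  rw [← star_jacobiOrbit, Pi.star_apply]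

lemma jacobiOrbit_eq_zero (a : ℕ → ℝ) {k n : ℕ} (h : k < n) (b : ℕ → ℂ) :
    jacobiOrbit a k b n = 0 := by
  induction k generalizing b n with
  | zero => simp [jacobiOrbit, h.ne']
  | succ k ih =>
    simp [jacobiOrbit, jacobiAct, ih (show k < n - 1 by omega), ih (show k < n by omega),
      ih (show k < n + 1 by omega)]

lemma jacobiOrbit_self (a : ℕ → ℝ) (k : ℕ) (b : ℕ → ℂ) :
    jacobiOrbit a k b k = ∏ i ∈ Finset.range k, (a i : ℂ) := by
  induction k generalizing b with
  | zero => simp [jacobiOrbit]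
  | succ k ih =>
    simp [jacobiOrbit, jacobiAct, ih, jacobiOrbit_eq_zero a (show k < k + 1 by omega),
      jacobiOrbit_eq_zero a (show k < k + 1 + 1 by omega), Finset.prod_range_succ, mul_comm]

lemma jacobiOrbit_self_ne_zero {a : ℕ → ℝ} (ha : ∀ n, 0 < a n) (k : ℕ) (b : ℕ → ℂ) :
    jacobiOrbit a k b k ≠ 0 := by
  rw [jacobiOrbit_self]
  exact Finset.prod_ne_zero_iff.2 fun i _ => by exact_mod_cast (ha i).ne'

/-- Green's formula. -/
lemma sum_jacobiAct_sub (a : ℕ → ℝ) (b u v : ℕ → ℂ) (M : ℕ) :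
    ∑ n ∈ Finset.range (M + 1), (jacobiAct a b u n * v n - u n * jacobiAct a b v n) =
      wronskian a u v M := by
  induction M with
  | zero => simp [jacobiAct, wronskian]; ring
  | succ M ih =>
    rw [Finset.sum_range_succ, ih]
    simp [jacobiAct, wronskian]; ring

lemma sum_jacobiAct_mul (a : ℕ → ℝ) (b u v : ℕ → ℂ) {M : ℕ}
    (hu : ∀ n, M ≤ n → u n = 0) :
    ∑ n ∈ Finset.range (M + 1), jacobiAct a b u n * v n =
      ∑ n ∈ Finset.range (M + 1), u n * jacobiAct a b v n := by
  rw [← sub_eq_zero, ← Finset.sum_sub_distrib, sum_jacobiAct_sub]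
  simp [wronskian, hu M le_rfl, hu (M + 1) (by omega)]

lemma sum_range_eq_of_eq_zero {f : ℕ → ℂ} {k M M' : ℕ} (h : k ≤ M) (h' : k ≤ M')
    (hf : ∀ n, k ≤ n → f n = 0) :
    ∑ n ∈ Finset.range M, f n = ∑ n ∈ Finset.range M', f n := by
  have aux : ∀ {m}, k ≤ m → ∑ n ∈ Finset.range m, f n = ∑ n ∈ Finset.range k, f n :=
    fun hm => (Finset.sum_subset (Finset.range_mono hm) fun n _ hn =>
      hf n (by simpa using hn)).symm
  rw [aux h, aux h']

/-- The bilinear pairing of two orbit vectors. -/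
def orbitPairing (a : ℕ → ℝ) (b : ℕ → ℂ) (i j : ℕ) : ℂ :=
  ∑ n ∈ Finset.range (i + 1), jacobiOrbit a i b n * jacobiOrbit a j (star b) n

lemma orbitPairing_eq_sum (a : ℕ → ℝ) (b : ℕ → ℂ) {i j M : ℕ} (h : i < M) :
    orbitPairing a b i j =
      ∑ n ∈ Finset.range M, jacobiOrbit a i b n * jacobiOrbit a j (star b) n :=
  sum_range_eq_of_eq_zero (k := i + 1) le_rfl h fun n hn => by
    rw [jacobiOrbit_eq_zero a hn, zero_mul]

lemma orbitPairing_zero_left (a : ℕ → ℝ) (b : ℕ → ℂ) (j : ℕ) :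
    orbitPairing a b 0 j = jacobiOrbit a j (star b) 0 := by
  simp [orbitPairing, jacobiOrbit]

lemma orbitPairing_succ_left (a : ℕ → ℝ) (b : ℕ → ℂ) (i j : ℕ) :
    orbitPairing a b (i + 1) j = orbitPairing a (star b) i (j + 1) := by
  rw [orbitPairing, orbitPairing_eq_sum a (star b) (show i < i + 1 + 1 by omega)]
  simp only [jacobiOrbit, star_star]
  exact sum_jacobiAct_mul a b _ _ fun n hn => jacobiOrbit_eq_zero a hn _

lemma orbitPairing_congr {a a' : ℕ → ℝ} {b b' : ℕ → ℂ} {L : ℕ}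
    (h : ∀ l ≤ L, jacobiOrbit a l b 0 = jacobiOrbit a' l b' 0) {i j : ℕ} (hij : i + j ≤ L) :
    orbitPairing a b i j = orbitPairing a' b' i j := by
  induction i generalizing j b b' with
  | zero =>
    rw [orbitPairing_zero_left, orbitPairing_zero_left, jacobiOrbit_star_apply,
      jacobiOrbit_star_apply, h j (by omega)]
  | succ i ih =>
    rw [orbitPairing_succ_left, orbitPairing_succ_left]
    refine ih (fun l hl => ?_) (by omega)
    rw [jacobiOrbit_star_apply, jacobiOrbit_star_apply, h l hl]

lemma jacobiOrbit_add_apply_zero (a : ℕ → ℝ) (b : ℕ → ℂ) (i j : ℕ) :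
    jacobiOrbit a (i + j) b 0 =
      if Even i then star (orbitPairing a b i j) else orbitPairing a b i j := by
  induction i generalizing b j with
  | zero => simp [orbitPairing_zero_left, jacobiOrbit_star_apply]
  | succ i ih =>
    have := congrArg star (ih (star b) (j + 1))
    rw [jacobiOrbit_star_apply, star_star, ← orbitPairing_succ_left,
      show i + (j + 1) = i + 1 + j by omega] at this
    rw [this]
    by_cases hi : Even i <;> simp [Nat.even_add_one, hi]

/-- `jacobiOrbit a k b` depends only on the first `k` coefficients. -/
lemma jacobiOrbit_congr {a a' : ℕ → ℝ} {b b' : ℕ → ℂ} {k : ℕ}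
    (h : ∀ n < k, a n = a' n ∧ b n = b' n) : jacobiOrbit a k b = jacobiOrbit a' k b' := by
  induction k generalizing b b' with
  | zero => rfl
  | succ k ih =>
    have e : jacobiOrbit a k (star b) = jacobiOrbit a' k (star b') :=
      ih fun n hn => ⟨(h n (by omega)).1, by simp [(h n (by omega)).2]⟩
    funext n
    simp only [jacobiOrbit, jacobiAct, e]
    have h1 : (a (n - 1) : ℂ) * jacobiOrbit a' k (star b') (n - 1) =
        a' (n - 1) * jacobiOrbit a' k (star b') (n - 1) := by
      rcases lt_or_ge k (n - 1) with hk | hk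
      · simp [jacobiOrbit_eq_zero a' hk]
      · rw [(h (n - 1) (by omega)).1]
    have h2 : b n * jacobiOrbit a' k (star b') n = b' n * jacobiOrbit a' k (star b') n := by
      rcases lt_or_ge k n with hk | hk
      · simp [jacobiOrbit_eq_zero a' hk]
      · rw [(h n (by omega)).2]
    have h3 : (a n : ℂ) * jacobiOrbit a' k (star b') (n + 1) =
        a' n * jacobiOrbit a' k (star b') (n + 1) := by
      rcases lt_or_ge k (n + 1) with hk | hk
      · simp [jacobiOrbit_eq_zero a' hk]
      · rw [(h n (by omega)).1]
    rw [h1, h2, h3]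

lemma jacobiOrbit_apply_zero_congr {a a' : ℕ → ℝ} {b b' : ℕ → ℂ} {K : ℕ}
    (h : ∀ n < K, a n = a' n ∧ b n = b' n) {L : ℕ} (hL : L ≤ 2 * K) :
    jacobiOrbit a L b 0 = jacobiOrbit a' L b' 0 := by
  have hs : ∀ n < K, a n = a' n ∧ star b n = star b' n := fun n hn =>
    ⟨(h n hn).1, by simp [(h n hn).2]⟩
  have aux : ∀ i j, i ≤ K → j ≤ K → orbitPairing a b i j = orbitPairing a' b' i j := by
    intro i j hi hj
    simp only [orbitPairing]
    rw [jacobiOrbit_congr (k := i) fun n hn => h n (by omega),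
      jacobiOrbit_congr (k := j) fun n hn => hs n (by omega)]
  rw [show L = min L K + (L - min L K) by omega, jacobiOrbit_add_apply_zero,
    jacobiOrbit_add_apply_zero,
    aux _ _ (by omega) (by omega)]

lemma coeff_eq_of_jacobiOrbit_apply_zero_eq {a a' : ℕ → ℝ} (ha : ∀ n, 0 < a n)
    (ha' : ∀ n, 0 < a' n) {b b' : ℕ → ℂ} {K : ℕ}
    (h : ∀ l ≤ 2 * K, jacobiOrbit a l b 0 = jacobiOrbit a' l b' 0) :
    ∀ n < K, a n = a' n ∧ b n = b' n := by
  intro n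
  induction n using Nat.strong_induction_on with
  | _ n ih =>
    intro hn
    have hlt : ∀ m < n, a m = a' m ∧ b m = b' m := fun m hm => ih m hm (by omega)
    have hlts : ∀ m < n, a m = a' m ∧ star b m = star b' m := fun m hm =>
      ⟨(hlt m hm).1, by simp [(hlt m hm).2]⟩
    have e : jacobiOrbit a n b = jacobiOrbit a' n b' := jacobiOrbit_congr hlt
    have es : jacobiOrbit a n (star b) = jacobiOrbit a' n (star b') := jacobiOrbit_congr hlts
    have low : ∀ (c c' : ℕ → ℂ), (∀ m < n, c m = c' m) →
        jacobiOrbit a n (star c) = jacobiOrbit a' n (star c') → ∀ m < n,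
        jacobiOrbit a (n + 1) c m = jacobiOrbit a' (n + 1) c' m := by
      intro c c' hc ec m hm
      simp only [jacobiOrbit, jacobiAct, ec, hc m hm, (hlt m hm).1,
        (hlt (m - 1) (by omega)).1]
    have hp := orbitPairing_congr h (show n + (n + 1) ≤ 2 * K by omega)
    have hq := orbitPairing_congr h (show n + 1 + (n + 1) ≤ 2 * K by omega)
    have hmid : ∀ (d : ℕ → ℝ) (c : ℕ → ℂ), jacobiOrbit d (n + 1) c n =
        (if n = 0 then 0 else (d (n - 1) : ℂ) * jacobiOrbit d n (star c) (n - 1)) +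
          c n * jacobiOrbit d n (star c) n := by
      intro d c
      simp [jacobiOrbit, jacobiAct, jacobiOrbit_eq_zero d (show n < n + 1 by omega)]
    have hprev : n ≠ 0 → a (n - 1) = a' (n - 1) := fun h0 => (hlt (n - 1) (by omega)).1
    have hb : star (b n) = star (b' n) := by
      simp only [orbitPairing] at hp
      rw [Finset.sum_range_succ, Finset.sum_range_succ, e, Finset.sum_congr rfl
        fun m hm => by rw [low _ _ (fun m hm => (hlts m hm).2)
          (by simpa using e) m (Finset.mem_range.1 hm)], add_right_inj] at hp
      have hne := jacobiOrbit_self_ne_zero ha' n b'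
      have hp := mul_left_cancel₀ hne hp
      rw [hmid, hmid, star_star, star_star, e] at hp
      have : (if n = 0 then 0 else (a (n - 1) : ℂ) * jacobiOrbit a' n b' (n - 1)) =
          if n = 0 then 0 else (a' (n - 1) : ℂ) * jacobiOrbit a' n b' (n - 1) := by
        split_ifs with h0
        · rfl
        · rw [hprev h0]
      rw [this, add_right_inj] at hp
      exact mul_right_cancel₀ hne hp
    have hb' : b n = b' n := star_injective hb
    refine ⟨?_, hb'⟩
    have low' : ∀ (c c' : ℕ → ℂ), (∀ m ≤ n, c m = c' m) →
        jacobiOrbit a n (star c) = jacobiOrbit a' n (star c') → ∀ m < n + 1,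
        jacobiOrbit a (n + 1) c m = jacobiOrbit a' (n + 1) c' m := by
      intro c c' hc ec m hm
      rcases Nat.lt_succ_iff_lt_or_eq.1 hm with hm | rfl
      · exact low c c' (fun m hm => hc m hm.le) ec m hm
      · rw [hmid, hmid, ec, hc m le_rfl]
        congr 1
        split_ifs with h0
        · rfl
        · rw [hprev h0]
    have hle : ∀ m ≤ n, b m = b' m := fun m hm => by
      rcases hm.lt_or_eq with hm | rfl
      · exact (hlt m hm).2
      · exact hb'
    simp only [orbitPairing] at hq
    rw [Finset.sum_range_succ _ (n + 1), Finset.sum_range_succ _ (n + 1), Finset.sum_congr rfl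
      fun m hm => by rw [low' _ _ hle es m (Finset.mem_range.1 hm),
        low' (star b) (star b') (fun m hm => by simp [hle m hm]) (by simpa using e) m
          (Finset.mem_range.1 hm)], add_right_inj] at hq
    simp only [jacobiOrbit_self, Finset.prod_range_succ] at hq
    have hprod : ∏ i ∈ Finset.range n, (a i : ℂ) = ∏ i ∈ Finset.range n, (a' i : ℂ) :=
      Finset.prod_congr rfl fun i hi => by rw [(hlt i (Finset.mem_range.1 hi)).1]
    have hne : ∏ i ∈ Finset.range n, (a' i : ℂ) ≠ 0 :=
      Finset.prod_ne_zero_iff.2 fun i _ => by exact_mod_cast (ha' i).ne'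
    rw [hprod] at hq
    have hsq : (a n : ℂ) * a n = a' n * a' n := by
      apply mul_left_cancel₀ (mul_ne_zero hne hne)
      linear_combination hq
    have hsq' : a n * a n = a' n * a' n := by exact_mod_cast hsq
    nlinarith [ha n, ha' n, mul_self_inj_of_nonneg (ha n).le (ha' n).le]

lemma jacobiOrbit_support_finite (a : ℕ → ℝ) (k : ℕ) (b : ℕ → ℂ) :
    (Function.support (jacobiOrbit a k b)).Finite :=
  (Finset.range (k + 1)).finite_toSet.subset fun n hn => by
    by_contra h
    exact hn (jacobiOrbit_eq_zero a (by simpa using h) b)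

/-- The orbit vectors as elements of `ℓ²(ℕ₀)`. -/
def orbitVec (a : ℕ → ℝ) (k : ℕ) (b : ℕ → ℂ) : H :=
  ⟨jacobiOrbit a k b,
    (memℓp_zero (jacobiOrbit_support_finite a k b)).of_exponent_ge zero_le⟩

lemma orbitVec_mem_domain (a : ℕ → ℝ) (b c : ℕ → ℂ) (k : ℕ) :
    orbitVec a k c ∈ (jacobiOp a b).domain :=
  finSupp_memℓp a b _ (jacobiOrbit_support_finite a k c)

lemma jacobiOp_orbitVec (a : ℕ → ℝ) (b : ℕ → ℂ) (k : ℕ) :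
    jacobiOp a b ⟨orbitVec a k (star b), orbitVec_mem_domain a b _ k⟩ =
      orbitVec a (k + 1) b := rfl

lemma dense_jacobiOp_domain (a : ℕ → ℝ) (b : ℕ → ℂ) :
    Dense ((jacobiOp a b).domain : Set H) := by
  intro u
  refine mem_closure_of_tendsto (lp.hasSum_single (by norm_num) u)
    (Filter.Eventually.of_forall fun s => Submodule.sum_mem _ fun n _ => ?_)
  refine finSupp_memℓp a b _ ((Set.finite_singleton n).subset fun m hm => ?_)
  by_contra h
  exact hm (lp.single_apply_ne 2 n _ h)

lemma inner_orbitVec (a : ℕ → ℝ) (b : ℕ → ℂ) {k M : ℕ} (h : k < M) (u : H) :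
    ⟪orbitVec a k b, u⟫_ℂ = ∑ n ∈ Finset.range M, jacobiOrbit a k (star b) n * u n := by
  rw [lp.inner_eq_tsum, tsum_eq_sum (s := Finset.range M)]
  · refine Finset.sum_congr rfl fun n _ => ?_
    rw [jacobiOrbit_star_apply, mul_comm]
    rfl
  · intro n hn
    have : orbitVec a k b n = 0 :=
      jacobiOrbit_eq_zero a (h.trans_le (by simpa using hn)) b
    rw [this, inner_zero_left]

lemma inner_orbitVec_orbitVec (a : ℕ → ℝ) (b : ℕ → ℂ) (i j : ℕ) :
    ⟪orbitVec a i (star b), orbitVec a j (star b)⟫_ℂ = orbitPairing a b i j := by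
  rw [inner_orbitVec a (star b) (Nat.lt_succ_self i), star_star]
  rfl

lemma inner_orbitVec_succ (a : ℕ → ℝ) (b : ℕ → ℂ) (k : ℕ) (x : (jacobiOp a b).domain) :
    ⟪orbitVec a (k + 1) (star b), (x : H)⟫_ℂ = ⟪orbitVec a k b, jacobiOp a b x⟫_ℂ := by
  rw [inner_orbitVec a (star b) (Nat.lt_succ_self (k + 1)),
    inner_orbitVec a b (show k < k + 1 + 1 by omega), star_star]
  exact sum_jacobiAct_mul a b _ _ fun n hn => jacobiOrbit_eq_zero a hn _

lemma IsJJResolvent.apply_orbitVec {a : ℕ → ℝ} {b : ℕ → ℂ} {w : ℂ} {R : H →L[ℂ] H}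
    (hR : IsJJResolvent a b w R) (k : ℕ) :
    R (orbitVec a (k + 2) (star b) - w • orbitVec a k (star b)) = orbitVec a k (star b) := by
  have h2 : jacobiOp a b ⟨orbitVec a k (star b), orbitVec_mem_domain a b _ k⟩ ∈
      (jacobiOp a b).adjoint.domain :=
    LinearPMap.mem_adjoint_domain_of_exists _
      ⟨orbitVec a (k + 2) (star b), fun x => inner_orbitVec_succ a b (k + 1) x⟩
  have h3 : (jacobiOp a b).adjoint ⟨_, h2⟩ = orbitVec a (k + 2) (star b) :=
    LinearPMap.adjoint_apply_eq (dense_jacobiOp_domain a b) _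
      fun x => inner_orbitVec_succ a b (k + 1) x
  have := hR.2 _ _ h2
  rwa [h3] at this

lemma IsJJResolvent.norm_apply_le {a : ℕ → ℝ} {b : ℕ → ℂ} {w : ℂ} {R : H →L[ℂ] H}
    (hR : IsJJResolvent a b w R) {d : ℝ} (hd : ∀ t : ℝ, 0 ≤ t → d ≤ ‖(t : ℂ) - w‖) (x : H) :
    d * ‖R x‖ ≤ ‖x‖ := by
  obtain ⟨h1, h2, h3⟩ := hR.1 x
  set u : H := R x
  set v : H := jacobiOp a b ⟨u, h1⟩ with hv
  rcases eq_or_ne u 0 with hu | hu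
  · simp [hu]
  have hpos : 0 < ‖u‖ := norm_pos_iff.2 hu
  have key : ⟪u, x⟫_ℂ = ((‖u‖ ^ 2 : ℝ) : ℂ) * (((‖v‖ ^ 2 / ‖u‖ ^ 2 : ℝ) : ℂ) - w) := by
    have hadj : ⟪u, (jacobiOp a b).adjoint ⟨v, h2⟩⟫_ℂ = ⟪v, v⟫_ℂ := by
      have := (jacobiOp a b).adjoint_isFormalAdjoint (dense_jacobiOp_domain a b)
        ⟨v, h2⟩ ⟨u, h1⟩
      rw [← inner_conj_symm, this, ← hv, inner_conj_symm]
    have hu' : (‖u‖ : ℂ) ≠ 0 := by exact_mod_cast hpos.ne'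
    rw [← h3, inner_sub_right, inner_smul_right, hadj, inner_self_eq_norm_sq_to_K,
      inner_self_eq_norm_sq_to_K]
    push_cast
    field_simp
    simp
  have hle := norm_inner_le_norm (𝕜 := ℂ) u x
  rw [key, norm_mul, Complex.norm_real, Real.norm_of_nonneg (by positivity)] at hle
  have := mul_le_mul_of_nonneg_left (hd _ (by positivity : 0 ≤ ‖v‖ ^ 2 / ‖u‖ ^ 2))
    (by positivity : 0 ≤ ‖u‖ ^ 2)
  nlinarith

lemma weylVec_eq_orbitVec (a : ℕ → ℝ) (b : ℕ → ℂ) (i : Fin 2) :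
    weylVec a b i = orbitVec a i (star b) := by
  ext n
  fin_cases i
  · simp [weylVec, orbitVec, jacobiOrbit]
  · rcases n with _ | _ | n <;> simp [weylVec, orbitVec, jacobiOrbit, jacobiAct]

/-- The asymptotic expansion of the Weyl matrix, with an explicit remainder bound. -/
lemma norm_weylM_add_sum_le {a : ℕ → ℝ} {b : ℕ → ℂ} {Res : ℂ → H →L[ℂ] H} {w : ℂ}
    (hR : IsJJResolvent a b w (Res w)) (hw : w ≠ 0) {c : ℝ} (hc : 0 < c)
    (hd : ∀ t : ℝ, 0 ≤ t → c * ‖w‖ ≤ ‖(t : ℂ) - w‖) (i j : Fin 2) (K : ℕ) :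
    ‖weylM a b Res w i j +
        ∑ k ∈ Finset.range K, orbitPairing a b j (i + 2 * k) / w ^ (k + 1)‖ ≤
      ‖orbitVec a j (star b)‖ * ‖orbitVec a (i + 2 * K) (star b)‖ / c / ‖w‖ ^ (K + 1) := by
  have exact_formula : weylM a b Res w i j +
      ∑ k ∈ Finset.range K, orbitPairing a b j (i + 2 * k) / w ^ (k + 1) =
      ⟪orbitVec a j (star b), Res w (orbitVec a (i + 2 * K) (star b))⟫_ℂ / w ^ K := by
    induction K with
    | zero => simp [weylM, weylVec_eq_orbitVec]
    | succ K ih =>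
      have h := hR.apply_orbitVec (i + 2 * K)
      rw [map_sub, map_smul, sub_eq_iff_eq_add] at h
      rw [Finset.sum_range_succ, ← add_assoc, ih, show i + 2 * (K + 1) = i + 2 * K + 2 by ring,
        h, inner_add_right, inner_smul_right, inner_orbitVec_orbitVec]
      field_simp
      ring
  have hpos : 0 < ‖w‖ := norm_pos_iff.2 hw
  have hb := hR.norm_apply_le hd (orbitVec a (i + 2 * K) (star b))
  rw [exact_formula, norm_div, norm_pow, div_div, div_le_div_iff₀ (by positivity) (by positivity)]
  calc _ ≤ ‖orbitVec a j (star b)‖ * ‖Res w (orbitVec a (i + 2 * K) (star b))‖ *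
          (c * ‖w‖ ^ (K + 1)) := by
        gcongr
        exact norm_inner_le_norm _ _
    _ = ‖orbitVec a j (star b)‖ * (c * ‖w‖ * ‖Res w (orbitVec a (i + 2 * K) (star b))‖) *
          ‖w‖ ^ K := by ring
    _ ≤ _ := by gcongr

lemma exists_sector_dist {ε : ℝ} (hε : 0 < ε) :
    ∃ c > (0 : ℝ), ∀ w : ℂ, arg2pi w ∈ Set.Icc ε (2 * Real.pi - ε) →
      ∀ t : ℝ, 0 ≤ t → c * ‖w‖ ≤ ‖(t : ℂ) - w‖ := by
  have hpi := Real.pi_pos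
  refine ⟨Real.sin (min ε (Real.pi / 2)), Real.sin_pos_of_pos_of_lt_pi
    (lt_min hε (by linarith)) ((min_le_right _ _).trans_lt (by linarith)), ?_⟩
  intro w hw t ht
  rcases le_or_gt w.re 0 with hre | hre
  · calc _ ≤ 1 * ‖w‖ := by gcongr; exact Real.sin_le_one _
      _ = ‖w‖ := one_mul _
      _ ≤ _ := by
        rw [← sq_le_sq₀ (norm_nonneg _) (norm_nonneg _), Complex.sq_norm, Complex.sq_norm,
          Complex.normSq_apply, Complex.normSq_apply]
        simp
        nlinarith
  · have habs : |w.arg| < Real.pi / 2 := Complex.abs_arg_lt_pi_div_two_iff.2 (Or.inl hre)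
    have hge : ε ≤ |w.arg| := by
      obtain ⟨h1, h2⟩ := hw
      unfold arg2pi at h1 h2
      split_ifs at h1 h2 with h
      · rwa [abs_of_nonneg h]
      · rw [abs_of_neg (not_le.1 h)]
        linarith
    calc _ ≤ Real.sin |w.arg| * ‖w‖ := by
          gcongr
          exact Real.sin_le_sin_of_le_of_le_pi_div_two
            (by linarith [le_min hε.le (by linarith : (0 : ℝ) ≤ Real.pi / 2)]) habs.le
            ((min_le_left _ _).trans hge)
      _ = |w.im| := by
          rw [← Real.abs_sin_eq_sin_abs_of_abs_le_pi (by linarith), Complex.sin_arg, abs_div,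
            abs_of_nonneg (norm_nonneg w)]
          exact div_mul_cancel₀ _ (norm_ne_zero_iff.2 (by rintro rfl; simp at hre))
      _ = |((t : ℂ) - w).im| := by simp
      _ ≤ _ := Complex.abs_im_le_norm _

lemma norm_apply_le_opnorm (A : Matrix (Fin 2) (Fin 2) ℂ) (i j : Fin 2) :
    ‖A i j‖ ≤ opnorm A := by
  have h := (Matrix.toEuclideanCLM (𝕜 := ℂ) A).le_opNorm (PiLp.single 2 j 1)
  rw [PiLp.norm_single, norm_one, mul_one] at h
  refine le_trans ?_ ((PiLp.norm_apply_le _ i).trans h)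
  rw [Matrix.ofLp_toEuclideanCLM]
  simp

lemma opnorm_le_sum (A : Matrix (Fin 2) (Fin 2) ℂ) :
    opnorm A ≤ ∑ i, ∑ j, ‖A i j‖ := by
  refine ContinuousLinearMap.opNorm_le_bound _ (by positivity) fun x => ?_
  have norm_le : ∀ y : EuclideanSpace ℂ (Fin 2), ‖y‖ ≤ ∑ i, ‖y i‖ := fun y => by
    rw [EuclideanSpace.norm_eq, Real.sqrt_le_iff, Fin.sum_univ_two, Fin.sum_univ_two]
    constructor
    · positivity
    · nlinarith [mul_nonneg (norm_nonneg (y 0)) (norm_nonneg (y 1))]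
  refine (norm_le _).trans ?_
  rw [Finset.sum_mul, Matrix.ofLp_toEuclideanCLM]
  refine Finset.sum_le_sum fun i _ => ?_
  rw [Finset.sum_mul, Matrix.mulVec, dotProduct]
  refine norm_sum_le_of_le _ fun j _ => ?_
  rw [norm_mul]
  gcongr
  exact PiLp.norm_apply_le x j

lemma norm_quarticRoot (w : ℂ) : ‖quarticRoot w‖ = ‖w‖ ^ ((1 : ℝ) / 4) := by
  rw [quarticRoot, norm_mul, Complex.norm_exp_ofReal_mul_I, mul_one, Complex.norm_real,
    Real.norm_of_nonneg (by positivity)]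

lemma norm_quarticRoot_sq (w : ℂ) : ‖quarticRoot w‖ ^ 2 = √‖w‖ := by
  rw [norm_quarticRoot, ← Real.rpow_mul_natCast (norm_nonneg w), Real.sqrt_eq_rpow]
  norm_num

lemma quarticRoot_ne_zero {w : ℂ} (hw : w ≠ 0) : quarticRoot w ≠ 0 := by
  rw [← norm_pos_iff, norm_quarticRoot]
  have := norm_pos_iff.2 hw
  positivity

lemma sigma3Root_mul_mul_apply (w : ℂ) (A : Matrix (Fin 2) (Fin 2) ℂ) (i j : Fin 2) :
    (sigma3Root w * A * sigma3Root w) i j =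
      ![quarticRoot w, (quarticRoot w)⁻¹] i * A i j * ![quarticRoot w, (quarticRoot w)⁻¹] j := by
  have : sigma3Root w = Matrix.diagonal ![quarticRoot w, (quarticRoot w)⁻¹] := by
    ext i j
    fin_cases i <;> fin_cases j <;> rfl
  rw [this, Matrix.mul_diagonal, Matrix.diagonal_mul]

lemma norm_scaled_zero_zero (w : ℂ) (A : Matrix (Fin 2) (Fin 2) ℂ) :
    ‖(sigma3Root w * A * sigma3Root w) 0 0‖ = √‖w‖ * ‖A 0 0‖ := by
  rw [← norm_quarticRoot_sq, sigma3Root_mul_mul_apply]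
  simp
  ring

lemma norm_scaled_zero_one {w : ℂ} (hw : w ≠ 0) (A : Matrix (Fin 2) (Fin 2) ℂ) :
    ‖(sigma3Root w * A * sigma3Root w) 0 1‖ = ‖A 0 1‖ := by
  have := quarticRoot_ne_zero hw
  rw [sigma3Root_mul_mul_apply]
  simp [mul_right_comm, this]

lemma norm_scaled_one_zero {w : ℂ} (hw : w ≠ 0) (A : Matrix (Fin 2) (Fin 2) ℂ) :
    ‖(sigma3Root w * A * sigma3Root w) 1 0‖ = ‖A 1 0‖ := by
  have := quarticRoot_ne_zero hw
  rw [sigma3Root_mul_mul_apply]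
  simp [mul_right_comm, this]

lemma norm_scaled_one_one (w : ℂ) (A : Matrix (Fin 2) (Fin 2) ℂ) :
    ‖(sigma3Root w * A * sigma3Root w) 1 1‖ = ‖A 1 1‖ / √‖w‖ := by
  rw [← norm_quarticRoot_sq, sigma3Root_mul_mul_apply]
  simp
  ring

lemma offHalfLine.ne_zero {w : ℂ} (hw : offHalfLine w) : w ≠ 0 := by
  rintro rfl
  simp [offHalfLine] at hw

/-- The asymptotic expansion of the difference of two Weyl matrices in a sector. -/
lemma exists_norm_weylM_sub_add_sum_le {a a' : ℕ → ℝ} {b b' : ℕ → ℂ}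
    {Res Res' : ℂ → H →L[ℂ] H}
    (hRes : ∀ w : ℂ, offHalfLine w → IsJJResolvent a b w (Res w))
    (hRes' : ∀ w : ℂ, offHalfLine w → IsJJResolvent a' b' w (Res' w))
    {ε : ℝ} (hε : 0 < ε) (i j : Fin 2) (K : ℕ) :
    ∃ C ≥ (0 : ℝ), ∀ w : ℂ, offHalfLine w → arg2pi w ∈ Set.Icc ε (2 * Real.pi - ε) →
      ‖(weylM a b Res w - weylM a' b' Res' w) i j + ∑ k ∈ Finset.range K,
        (orbitPairing a b j (i + 2 * k) - orbitPairing a' b' j (i + 2 * k)) / w ^ (k + 1)‖ ≤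
      C / ‖w‖ ^ (K + 1) := by
  obtain ⟨c, hc, hd⟩ := exists_sector_dist hε
  refine ⟨‖orbitVec a j (star b)‖ * ‖orbitVec a (i + 2 * K) (star b)‖ / c +
    ‖orbitVec a' j (star b')‖ * ‖orbitVec a' (i + 2 * K) (star b')‖ / c, by positivity,
    fun w hw hs => ?_⟩
  have h := norm_weylM_add_sum_le (hRes w hw) hw.ne_zero hc (hd w hs) i j K
  have h' := norm_weylM_add_sum_le (hRes' w hw) hw.ne_zero hc (hd w hs) i j K
  rw [add_div]
  refine le_trans (le_of_eq ?_) ((norm_sub_le _ _).trans (add_le_add h h'))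
  simp only [sub_div, Finset.sum_sub_distrib, Matrix.sub_apply]
  congr 1
  ring

/-- The coefficients of an asymptotic expansion in inverse powers vanish up to the order to
which the function itself is small. -/
lemma asymptotic_coeff_eq_zero {f c : ℕ → ℂ} {ws : ℕ → ℂ} {K : ℕ}
    (hws : Filter.Tendsto (fun n => ‖ws n‖) Filter.atTop Filter.atTop)
    (hexp : ∀ K, ∃ C : ℝ, ∀ n,
      ‖f n + ∑ k ∈ Finset.range K, c k / ws n ^ (k + 1)‖ ≤ C / ‖ws n‖ ^ (K + 1))
    (hf : Filter.Tendsto (fun n => ‖ws n‖ ^ K * ‖f n‖) Filter.atTop (nhds 0)) :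
    ∀ k < K, c k = 0 := by
  intro k
  induction k using Nat.strong_induction_on with
  | _ k ih =>
    intro hk
    obtain ⟨C, hC⟩ := hexp (k + 1)
    have hlim : Filter.Tendsto (fun n => ‖ws n‖ ^ K * ‖f n‖ + C * ‖ws n‖⁻¹)
        Filter.atTop (nhds 0) := by
      simpa using hf.add ((tendsto_inv_atTop_zero.comp hws).const_mul C)
    refine norm_le_zero_iff.1 (ge_of_tendsto hlim ?_)
    filter_upwards [hws.eventually_ge_atTop 1] with n hn
    have hpos : 0 < ‖ws n‖ := by linarith
    have h := hC n
    rw [Finset.sum_range_succ, Finset.sum_eq_zero fun m hm => by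
      rw [ih m (Finset.mem_range.1 hm) ((Finset.mem_range.1 hm).trans hk), zero_div],
      zero_add] at h
    have h1 : ‖c k / ws n ^ (k + 1)‖ ≤ C / ‖ws n‖ ^ (k + 1 + 1) + ‖f n‖ := by
      calc _ = ‖(f n + c k / ws n ^ (k + 1)) - f n‖ := by rw [add_sub_cancel_left]
        _ ≤ _ := (norm_sub_le _ _).trans (by gcongr)
    rw [norm_div, norm_pow, div_le_iff₀ (by positivity)] at h1
    calc ‖c k‖ ≤ _ := h1
      _ = ‖ws n‖ ^ (k + 1) * ‖f n‖ + C * ‖ws n‖⁻¹ := by field_simp; ring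
      _ ≤ _ := by
        gcongr
        exact hk

lemma coeff_eq_of_weylM_close {a a' : ℕ → ℝ} (ha : ∀ n, 0 < a n) (ha' : ∀ n, 0 < a' n)
    {b b' : ℕ → ℂ} {Res Res' : ℂ → H →L[ℂ] H}
    (hRes : ∀ w : ℂ, offHalfLine w → IsJJResolvent a b w (Res w))
    (hRes' : ∀ w : ℂ, offHalfLine w → IsJJResolvent a' b' w (Res' w))
    {K : ℕ} {ε C : ℝ} (hε : 0 < ε) {ws : ℕ → ℂ}
    (hws : Filter.Tendsto (fun j => ‖ws j‖) Filter.atTop Filter.atTop)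
    (hoff : ∀ j, offHalfLine (ws j))
    (hsec : ∀ j, arg2pi (ws j) ∈ Set.Icc ε (2 * Real.pi - ε))
    (hle : ∀ j, opnorm (sigma3Root (ws j) *
      (weylM a b Res (ws j) - weylM a' b' Res' (ws j)) * sigma3Root (ws j)) ≤
        C / ‖ws j‖ ^ (K + 1)) :
    ∀ n < K, a n = a' n ∧ b n = b' n := by
  have hexp : ∀ i j : Fin 2, ∀ K, ∃ C : ℝ, ∀ n,
      ‖(weylM a b Res (ws n) - weylM a' b' Res' (ws n)) i j + ∑ k ∈ Finset.range K,
        (orbitPairing a b j (i + 2 * k) - orbitPairing a' b' j (i + 2 * k)) / ws n ^ (k + 1)‖ ≤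
      C / ‖ws n‖ ^ (K + 1) := fun i j K => by
    obtain ⟨C, -, hC⟩ := exists_norm_weylM_sub_add_sum_le hRes hRes' hε i j K
    exact ⟨C, fun n => hC _ (hoff n) (hsec n)⟩
  have hpos : ∀ n, 0 < ‖ws n‖ := fun n => norm_pos_iff.2 (hoff n).ne_zero
  have hEven : ∀ k < K + 1, orbitPairing a b 0 (2 * k) = orbitPairing a' b' 0 (2 * k) := by
    intro k hk
    have := asymptotic_coeff_eq_zero (K := K + 1) hws (hexp 0 0) ?_ k hk
    · simpa [sub_eq_zero] using this
    have hlim : Filter.Tendsto (fun n => C * (√‖ws n‖)⁻¹) Filter.atTop (nhds 0) := by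
      simpa using ((tendsto_inv_atTop_zero.comp
        (Real.tendsto_sqrt_atTop.comp hws)).const_mul C)
    refine squeeze_zero (fun n => by positivity) (fun n => ?_) hlim
    have h := (norm_apply_le_opnorm _ 0 0).trans (hle n)
    have hs := Real.sqrt_pos.2 (hpos n)
    have hp := hpos n
    rw [norm_scaled_zero_zero, le_div_iff₀ (by positivity)] at h
    rw [← div_eq_mul_inv, le_div_iff₀ hs]
    linarith
  have hOdd : ∀ k < K, orbitPairing a b 1 (2 * k) = orbitPairing a' b' 1 (2 * k) := by
    intro k hk
    have := asymptotic_coeff_eq_zero (K := K) hws (hexp 0 1) ?_ k hk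
    · simpa [sub_eq_zero] using this
    have hlim : Filter.Tendsto (fun n => C * ‖ws n‖⁻¹) Filter.atTop (nhds 0) := by
      simpa using ((tendsto_inv_atTop_zero.comp hws).const_mul C)
    refine squeeze_zero (fun n => by positivity) (fun n => ?_) hlim
    have h := (norm_apply_le_opnorm _ 0 1).trans (hle n)
    have hp := hpos n
    rw [norm_scaled_zero_one (hoff n).ne_zero, le_div_iff₀ (by positivity), pow_succ] at h
    rw [← div_eq_mul_inv, le_div_iff₀ hp]
    linarith
  refine coeff_eq_of_jacobiOrbit_apply_zero_eq ha ha' fun l hl => ?_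
  rcases Nat.even_or_odd' l with ⟨k, rfl | rfl⟩
  · rw [← zero_add (2 * k), jacobiOrbit_add_apply_zero, jacobiOrbit_add_apply_zero,
      hEven k (by omega)]
  · rw [add_comm (2 * k), jacobiOrbit_add_apply_zero, jacobiOrbit_add_apply_zero,
      hOdd k (by omega)]

lemma exists_weylM_close_of_coeff_eq {a a' : ℕ → ℝ}
    {b b' : ℕ → ℂ} {Res Res' : ℂ → H →L[ℂ] H}
    (hRes : ∀ w : ℂ, offHalfLine w → IsJJResolvent a b w (Res w))
    (hRes' : ∀ w : ℂ, offHalfLine w → IsJJResolvent a' b' w (Res' w))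
    {K : ℕ} (h : ∀ n < K, a n = a' n ∧ b n = b' n) {ε : ℝ} (hε : 0 < ε) :
    ∃ C > (0 : ℝ), ∀ w : ℂ, 1 ≤ ‖w‖ → offHalfLine w →
      arg2pi w ∈ Set.Icc ε (2 * Real.pi - ε) →
      opnorm (sigma3Root w * (weylM a b Res w - weylM a' b' Res' w) * sigma3Root w) ≤
        C / ‖w‖ ^ (K + 1) := by
  have entry : ∀ (i j : Fin 2) (m : ℕ), (i : ℕ) + j + 2 * m ≤ 2 * (K + 1) →
      ∃ C ≥ (0 : ℝ), ∀ w : ℂ, offHalfLine w → arg2pi w ∈ Set.Icc ε (2 * Real.pi - ε) →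
        ‖(weylM a b Res w - weylM a' b' Res' w) i j‖ ≤ C / ‖w‖ ^ (m + 1) := by
    intro i j m hm
    obtain ⟨C, hC0, hC⟩ := exists_norm_weylM_sub_add_sum_le hRes hRes' hε i j m
    refine ⟨C, hC0, fun w hw hs => ?_⟩
    have := hC w hw hs
    rwa [Finset.sum_eq_zero fun k hk => ?_, add_zero] at this
    rw [orbitPairing_congr (L := 2 * K) (fun l hl => jacobiOrbit_apply_zero_congr h hl)
      (by have := Finset.mem_range.1 hk; omega), sub_self, zero_div]
  obtain ⟨C₀₀, h₀₀, H₀₀⟩ := entry 0 0 (K + 1) (by simp)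
  obtain ⟨C₀₁, h₀₁, H₀₁⟩ := entry 0 1 K (by simp; omega)
  obtain ⟨C₁₀, h₁₀, H₁₀⟩ := entry 1 0 K (by simp; omega)
  obtain ⟨C₁₁, h₁₁, H₁₁⟩ := entry 1 1 K (by simp; omega)
  refine ⟨C₀₀ + C₀₁ + (C₁₀ + C₁₁) + 1, by positivity, fun w h1 hw hs => ?_⟩
  have hpos : 0 < ‖w‖ := by linarith
  have hsq1 : 1 ≤ √‖w‖ := Real.one_le_sqrt.2 h1
  refine (opnorm_le_sum _).trans ?_
  simp only [Fin.sum_univ_two]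
  rw [norm_scaled_zero_zero, norm_scaled_zero_one hw.ne_zero, norm_scaled_one_zero hw.ne_zero,
    norm_scaled_one_one]
  have e₀₀ : √‖w‖ * ‖(weylM a b Res w - weylM a' b' Res' w) 0 0‖ ≤ C₀₀ / ‖w‖ ^ (K + 1) := by
    have hsqrt : √‖w‖ ≤ ‖w‖ := Real.sqrt_le_iff.2 ⟨hpos.le, by nlinarith⟩
    calc _ ≤ ‖w‖ * (C₀₀ / ‖w‖ ^ (K + 1 + 1)) :=
          mul_le_mul hsqrt (H₀₀ w hw hs) (norm_nonneg _) hpos.le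
      _ = _ := by rw [pow_succ]; field_simp
  have e₁₁ : ‖(weylM a b Res w - weylM a' b' Res' w) 1 1‖ / √‖w‖ ≤ C₁₁ / ‖w‖ ^ (K + 1) :=
    (div_le_self (norm_nonneg _) hsq1).trans (H₁₁ w hw hs)
  have e : (0 : ℝ) ≤ 1 / ‖w‖ ^ (K + 1) := by positivity
  simp only [add_div]
  linarith [H₀₁ w hw hs, H₁₀ w hw hs]

/-- **Local Borg–Marchenko theorem for unbounded non-self-adjoint Jacobi matrices**
(Theorem 1.4): for proper Jacobi matrices `J(a,b)`, `J(a',b')` with Weyl matrices `M`,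
`M'` and `N ≥ 2`, the following are equivalent: (1) `‖w_j^{σ₃/4}(M(w_j) − M'(w_j))w_j^{σ₃/4}‖
= O(w_j^{−N})` along one fixed nontangential sequence `w_j → ∞`; (2) `aₙ = a'ₙ` and
`bₙ = b'ₙ` for all `n ≤ N − 2`; (3) the same `O(w^{−N})` bound holds in every sector
`arg w ∈ [ε, 2π − ε]`. -/
theorem local_borg_marchenko
    (a a' : ℕ → ℝ) (ha : ∀ n, 0 < a n) (ha' : ∀ n, 0 < a' n) (b b' : ℕ → ℂ)
    (hproper : (jacobiOp₀ a b).closure = jacobiOp a b)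
    (hproper' : (jacobiOp₀ a' b').closure = jacobiOp a' b')
    (Res Res' : ℂ → H →L[ℂ] H)
    (hRes : ∀ w : ℂ, offHalfLine w → IsJJResolvent a b w (Res w))
    (hRes' : ∀ w : ℂ, offHalfLine w → IsJJResolvent a' b' w (Res' w))
    (N : ℕ) (hN : 2 ≤ N) :
    ((∃ ε > (0 : ℝ), ∃ C > (0 : ℝ), ∃ ws : ℕ → ℂ,
        Filter.Tendsto (fun j => ‖ws j‖) Filter.atTop Filter.atTop ∧
        (∀ j, offHalfLine (ws j)) ∧
        (∀ j, arg2pi (ws j) ∈ Set.Icc ε (2 * Real.pi - ε)) ∧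
        (∀ j, opnorm (sigma3Root (ws j) *
            (weylM a b Res (ws j) - weylM a' b' Res' (ws j)) * sigma3Root (ws j)) ≤
          C / ‖ws j‖ ^ N)) ↔
      (∀ n : ℕ, n ≤ N - 2 → a n = a' n ∧ b n = b' n)) ∧
    ((∀ n : ℕ, n ≤ N - 2 → a n = a' n ∧ b n = b' n) ↔
      (∀ ε > (0 : ℝ), ∃ C > (0 : ℝ), ∃ Rad > (0 : ℝ), ∀ w : ℂ,
        Rad ≤ ‖w‖ → offHalfLine w →
        arg2pi w ∈ Set.Icc ε (2 * Real.pi - ε) →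
        opnorm (sigma3Root w * (weylM a b Res w - weylM a' b' Res' w) * sigma3Root w) ≤
          C / ‖w‖ ^ N)) := by
  obtain ⟨K, rfl⟩ : ∃ K, N = K + 1 := ⟨N - 1, by omega⟩
  have hiff : (∀ n : ℕ, n ≤ K + 1 - 2 → a n = a' n ∧ b n = b' n) ↔
      ∀ n < K, a n = a' n ∧ b n = b' n :=
    forall_congr' fun n => imp_congr_left (by omega)
  rw [hiff]
  have close_of_eq := fun h : ∀ n < K, a n = a' n ∧ b n = b' n =>
    fun (ε : ℝ) (hε : 0 < ε) => exists_weylM_close_of_coeff_eq hRes hRes' h hε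
  have tendsto_norm : ∀ r : ℝ, Filter.Tendsto (fun j : ℕ => ‖(-(r + 1 + j : ℝ) : ℂ)‖)
      Filter.atTop Filter.atTop := fun r => by
    have := Filter.tendsto_atTop_add_const_left Filter.atTop (r + 1)
      (tendsto_natCast_atTop_atTop (R := ℝ))
    refine Filter.tendsto_atTop_mono (fun j => ?_) this
    rw [norm_neg, Complex.norm_real]
    exact le_abs_self _
  have off_neg : ∀ r : ℝ, 0 < r → offHalfLine (-(r : ℂ)) := fun r hr => by
    simp [offHalfLine, hr]
  have arg_neg : ∀ r : ℝ, 0 < r → arg2pi (-(r : ℂ)) ∈ Set.Icc 1 (2 * Real.pi - 1) :=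
    fun r hr => by
    rw [arg2pi, ← Complex.ofReal_neg, Complex.arg_ofReal_of_neg (neg_lt_zero.2 hr),
      if_pos Real.pi_pos.le]
    constructor <;> linarith [Real.pi_gt_three]
  have eq_of_seq : ∀ ε > (0 : ℝ), ∀ C : ℝ, ∀ ws : ℕ → ℂ, _ → _ → _ → _ →
      ∀ n < K, a n = a' n ∧ b n = b' n := fun ε hε C ws h1 h2 h3 h4 =>
    coeff_eq_of_weylM_close (ε := ε) (C := C) (ws := ws) ha ha' hRes hRes' hε h1 h2 h3 h4
  refine ⟨⟨?_, fun h => ?_⟩, fun h ε hε => ?_, fun h => ?_⟩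
  · rintro ⟨ε, hε, C, -, ws, h1, h2, h3, h4⟩
    exact eq_of_seq ε hε C ws h1 h2 h3 h4
  · obtain ⟨C, hC, hb⟩ := close_of_eq h 1 one_pos
    have hpos : ∀ j : ℕ, (0 : ℝ) < 0 + 1 + j := fun j => by positivity
    refine ⟨1, one_pos, C, hC, _, tendsto_norm 0, fun j => off_neg _ (hpos j),
      fun j => arg_neg _ (hpos j), fun j => hb _ ?_ (off_neg _ (hpos j)) (arg_neg _ (hpos j))⟩
    rw [norm_neg, Complex.norm_real, Real.norm_of_nonneg (hpos j).le]
    simp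
  · obtain ⟨C, hC, hb⟩ := close_of_eq h ε hε
    exact ⟨C, hC, 1, one_pos, hb⟩
  · obtain ⟨C, hC, Rad, hRad, hb⟩ := h 1 one_pos
    have hpos : ∀ j : ℕ, (0 : ℝ) < Rad + 1 + j := fun j => by positivity
    refine eq_of_seq 1 one_pos C _ (tendsto_norm Rad) (fun j => off_neg _ (hpos j))
      (fun j => arg_neg _ (hpos j))
      fun j => hb _ ?_ (off_neg _ (hpos j)) (arg_neg _ (hpos j))
    rw [norm_neg, Complex.norm_real, Real.norm_of_nonneg (hpos j).le]
    have : (0 : ℝ) ≤ j := j.cast_nonneg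
    linarith

end
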